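/- Let F be a degree-three foliation of ℙ²(ℂ) with a singular point m of algebraic multiplicity 3, so that after a linear change of coordinates F is given in the chart z = 1 by ω = A dx + B dy + C(x dy − y dx) with A, B, C ∈ ℂ[x,y] homogeneous of degree 3 and m = [0:0:1]. Assume the singular locus of F is not reduced to m (the homogeneous coefficients of the associated 1-form Ω have a common projective zero other than [0:0:1]), and that the 3-jet A dx + B dy of ω at m is not saturated, i.e. A and B have a nonconstant common factor. Then ω is, up to the action of an automorphism of ℙ²(ℂ) (GL₃(ℂ)-pullback of Ω up to a nonzero scalar), of the type y(a₀x² + a₁xy + y²)dx + xy(b₀x + b₁y)dy + x(x² + c₁xy + c₂y²)(x dy − y dx), for complex numbers a₀, a₁, b₀, b₁, c₁, c₂ such that the associated foliation has degree 3. -/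

import Mathlib

open MvPolynomial

noncomputable section

/-- The inclusion `ℂ[x,y] → ℂ[x,y,z]`. -/
def emb : MvPolynomial (Fin 2) ℂ →ₐ[ℂ] MvPolynomial (Fin 3) ℂ :=
  rename Fin.castSucc

/-- The homogeneous projective 1-form
`Ω = (zA − yC) dx + (zB + xC) dy − (xA + yB) dz`
associated to the affine 1-form `ω = A dx + B dy + C (x dy − y dx)` of a degree-3
foliation with a singular point of algebraic multiplicity 3 at the origin
(`A`, `B`, `C` homogeneous of degree 3). -/
def OmABC (A B Cc : MvPolynomial (Fin 2) ℂ) : Fin 3 → MvPolynomial (Fin 3) ℂ :=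
  ![X 2 * emb A - X 1 * emb Cc,
    X 2 * emb B + X 0 * emb Cc,
    -(X 0 * emb A + X 1 * emb B)]

/-- Substitution of the linear change of variables on `ℂ³` given by the matrix `M`. -/
def subst3 (M : Matrix (Fin 3) (Fin 3) ℂ) (P : MvPolynomial (Fin 3) ℂ) :
    MvPolynomial (Fin 3) ℂ :=
  aeval (fun i => ∑ j, C (M i j) * X j) P

/-- Pullback of the 1-form with coefficient vector `Ω` by the linear map of matrix `M`. -/
def pb3 (M : Matrix (Fin 3) (Fin 3) ℂ) (Ω : Fin 3 → MvPolynomial (Fin 3) ℂ) :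
    Fin 3 → MvPolynomial (Fin 3) ℂ :=
  fun i => ∑ j, C (M j i) * subst3 M (Ω j)

/-- Two projective 1-forms are linearly conjugate: `T*Ω = c·Ω'` for some
`T ∈ GL₃(ℂ)` and `c ∈ ℂ*`. -/
def LinConj3 (Ω Ω' : Fin 3 → MvPolynomial (Fin 3) ℂ) : Prop :=
  ∃ (M : Matrix (Fin 3) (Fin 3) ℂ) (c : ℂ), IsUnit M.det ∧ c ≠ 0 ∧
    pb3 M Ω = fun i => C c * Ω' i

lemma cubic_form (P : MvPolynomial (Fin 2) ℂ) (hP : P.IsHomogeneous 3) :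
    ∃ a b c d : ℂ, P = C a * X 0 ^ 3 + C b * X 0 ^ 2 * X 1 + C c * X 0 * X 1 ^ 2 + C d * X 1 ^ 3 := by
  let f : ℕ → ℕ → (Fin 2 →₀ ℕ) := fun i j => Finsupp.single 0 i + Finsupp.single 1 j
  have hmon : ∀ (a : ℂ) (i j : ℕ), (monomial (f i j) a : MvPolynomial (Fin 2) ℂ)
      = C a * X 0 ^ i * X 1 ^ j := by
    intro a i j
    simp only [f, X_pow_eq_monomial, C_mul_monomial, monomial_mul, mul_one]
  refine ⟨coeff (f 3 0) P, coeff (f 2 1) P, coeff (f 1 2) P, coeff (f 0 3) P, ?_⟩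
  have : P = monomial (f 3 0) (coeff (f 3 0) P) + monomial (f 2 1) (coeff (f 2 1) P)
     + monomial (f 1 2) (coeff (f 1 2) P) + monomial (f 0 3) (coeff (f 0 3) P) := by
    ext m
    obtain ⟨i, j, rfl⟩ : ∃ i j, m = f i j := ⟨m 0, m 1, by
      ext k; fin_cases k <;> simp [f]⟩
    have hinj : ∀ i j i' j', f i j = f i' j' ↔ i = i' ∧ j = j' := by
      intro i j i' j'
      constructor
      · intro h
        have h0 := DFunLike.congr_fun h 0
        have h1 := DFunLike.congr_fun h 1
        simp [f] at h0 h1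
        exact ⟨h0, h1⟩
      · rintro ⟨rfl, rfl⟩; rfl
    simp only [coeff_add, coeff_monomial, hinj]
    by_cases hij : i + j = 3
    · have : i ≤ 3 := by omega
      interval_cases i
      · obtain rfl : j = 3 := by omega
        simp
      · obtain rfl : j = 2 := by omega
        simp
      · obtain rfl : j = 1 := by omega
        simp
      · obtain rfl : j = 0 := by omega
        simp
    · rw [hP.coeff_eq_zero (d := f i j)]
      · rw [if_neg (by omega), if_neg (by omega), if_neg (by omega), if_neg (by omega)]; simp
      · simpa [f, Finsupp.degree_eq_sum] using hij
  rw [hmon, hmon, hmon, hmon] at this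
  simpa using this

lemma cubic_dvd (P : MvPolynomial (Fin 2) ℂ) (hP : P.IsHomogeneous 3) (p : Fin 2 → ℂ)
    (hp : p ≠ 0) (h0 : eval p P = 0) : (C (p 1) * X 0 - C (p 0) * X 1) ∣ P := by
  obtain ⟨a, b, c, d, rfl⟩ := cubic_form P hP
  simp at h0
  by_cases hp0 : p 0 = 0
  · have hp1 : p 1 ≠ 0 := fun h => hp (by ext k; fin_cases k <;> simp [*])
    have hd : d = 0 := by simpa [hp0, hp1] using h0
    refine ⟨C (p 1)⁻¹ * (C a * X 0 ^ 2 + C b * X 0 * X 1 + C c * X 1 ^ 2), ?_⟩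
    apply MvPolynomial.funext
    intro x
    simp [hp0, hd]
    field_simp
  · refine ⟨- C ((p 0)⁻¹ ^ 3) * (C b * C (p 0) ^ 2 * X 0 ^ 2 +
      C c * C (p 0) * X 0 * (C (p 0) * X 1 + C (p 1) * X 0) +
      C d * (C (p 0) ^ 2 * X 1 ^ 2 + C (p 0) * C (p 1) * X 0 * X 1 + C (p 1) ^ 2 * X 0 ^ 2)), ?_⟩
    apply MvPolynomial.funext
    intro x
    simp
    field_simp
    linear_combination (x 0) ^ 3 * h0

lemma exists_zero (h : MvPolynomial (Fin 2) ℂ) (hu : ¬ IsUnit h) :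
    ∃ p : Fin 2 → ℂ, p ≠ 0 ∧ eval p h = 0 := by
  by_contra! hcon
  have key : ∀ i, ∃ n, h ∣ (X i : MvPolynomial (Fin 2) ℂ) ^ n := by
    intro i
    have hm : (X i : MvPolynomial (Fin 2) ℂ) ∈ vanishingIdeal ℂ (zeroLocus ℂ (Ideal.span {h})) := by
      rw [mem_vanishingIdeal_iff]
      intro x hx
      rw [mem_zeroLocus_iff] at hx
      have h1 := hx h (Ideal.subset_span rfl)
      have : x = 0 := by
        by_contra hx0
        exact hcon x hx0 (by simpa [aeval_eq_eval] using h1)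
      simp [this]
    rw [vanishingIdeal_zeroLocus_eq_radical] at hm
    obtain ⟨n, hn⟩ := hm
    exact ⟨n, Ideal.mem_span_singleton.mp hn⟩
  obtain ⟨n, hn⟩ := key 0
  obtain ⟨m, hm⟩ := key 1
  obtain ⟨k, -, hk⟩ := (dvd_prime_pow (X_prime (R := ℂ) (i := (0 : Fin 2))) n).mp hn
  rcases k with _ | k
  · exact hu (by simpa using hk)
  · have : (X 0 : MvPolynomial (Fin 2) ℂ) ∣ X 1 ^ m :=
      (dvd_pow_self _ (Nat.succ_ne_zero k)).trans (hk.symm.dvd.trans hm)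
    obtain ⟨q, hq⟩ := this
    have := congrArg (eval ![0, 1]) hq
    simp at this

lemma isUnit_transfer (M : Matrix (Fin 3) (Fin 3) ℂ) (c : ℂ) (hM : IsUnit M.det)
    (Ω Ω' : Fin 3 → MvPolynomial (Fin 3) ℂ) (hpb : pb3 M Ω = fun i => C c * Ω' i)
    (hΩ : ∀ h : MvPolynomial (Fin 3) ℂ, (∀ i, h ∣ Ω i) → IsUnit h)
    (h : MvPolynomial (Fin 3) ℂ) (hd : ∀ i, h ∣ Ω' i) : IsUnit h := by
  have hcomp : ∀ (M N : Matrix (Fin 3) (Fin 3) ℂ) (_ : M * N = 1) (P), subst3 N (subst3 M P) = P := by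
    intro M N hMN P
    unfold subst3
    have : ((aeval (fun i => ∑ j, C (N i j) * X j)).comp (aeval (fun i => ∑ j, C (M i j) * X j)) :
      MvPolynomial (Fin 3) ℂ →ₐ[ℂ] MvPolynomial (Fin 3) ℂ) = AlgHom.id ℂ _ := by
      apply MvPolynomial.algHom_ext
      intro i
      apply MvPolynomial.funext
      intro x
      have h1 := congrFun (congrArg (fun Q => Matrix.mulVec Q x) hMN) i
      simp only [← Matrix.mulVec_mulVec, Matrix.one_mulVec] at h1
      simp [Matrix.mulVec, dotProduct] at h1 ⊢
      simpa [aeval_def, algebraMap_eq] using h1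
    exact DFunLike.congr_fun this P
  have hdv : ∀ k, h ∣ subst3 M (Ω k) := by
    intro k
    have e : subst3 M (Ω k) = ∑ i, C (M⁻¹ i k) * pb3 M Ω i := by
      have hh := Matrix.mul_nonsing_inv M hM
      unfold pb3
      have e2 : ∀ j, ∑ i, M j i * M⁻¹ i k = if j = k then 1 else 0 := by
        intro j
        have := congrFun (congrFun hh j) k
        rwa [Matrix.mul_apply, Matrix.one_apply] at this
      simp_rw [Finset.mul_sum]
      rw [Finset.sum_comm]
      have e3 : ∀ j, ∑ i, C (M⁻¹ i k) * (C (M j i) * subst3 M (Ω j))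
         = C (if j = k then 1 else 0) * subst3 M (Ω j) := by
        intro j
        rw [← e2 j, map_sum, Finset.sum_mul]
        refine Finset.sum_congr rfl fun i _ => ?_
        rw [C_mul]; ring
      simp_rw [e3]
      simp [apply_ite]
    rw [e, hpb]
    exact Finset.dvd_sum fun i _ => ((hd i).mul_left _).mul_left _
  have hu : IsUnit (subst3 M⁻¹ h) := by
    apply hΩ
    intro k
    have := hdv k
    rw [← hcomp M M⁻¹ (Matrix.mul_nonsing_inv M hM) (Ω k)]
    exact map_dvd (aeval (fun i => ∑ j, C (M⁻¹ i j) * X j)) this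
  rw [← hcomp M⁻¹ M (Matrix.nonsing_inv_mul M hM) h]
  exact hu.map (aeval (fun i => ∑ j, C (M i j) * X j))

def sub2 (p v : Fin 2 → ℂ) : MvPolynomial (Fin 2) ℂ →ₐ[ℂ] MvPolynomial (Fin 2) ℂ :=
  aeval (fun i => C (p i) * X 0 + C (v i) * X 1)

lemma eval_aeval' {σ τ : Type} (g : σ → MvPolynomial τ ℂ) (x : τ → ℂ) (P : MvPolynomial σ ℂ) :
    eval x (aeval g P) = eval (fun i => eval x (g i)) P := by
  induction P using MvPolynomial.induction_on with
  | C a => simp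
  | add p q hp hq => rw [map_add, map_add, map_add, hp, hq]
  | mul_X p i hp => rw [map_mul, map_mul, map_mul, hp]; simp

lemma eval_sub2 (p v x : Fin 2 → ℂ) (P) :
    eval x (sub2 p v P) = eval (fun i => p i * x 0 + v i * x 1) P := by
  rw [sub2, eval_aeval']
  simp

lemma eval_emb (x : Fin 3 → ℂ) (P) : eval x (emb P) = eval ![x 0, x 1] P := by
  rw [emb, eval_rename]
  congr 2
  ext i; fin_cases i <;> rfl

lemma eval_subst3 (M : Matrix (Fin 3) (Fin 3) ℂ) (x : Fin 3 → ℂ) (P) :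
    eval x (subst3 M P) = eval (M.mulVec x) P := by
  rw [subst3, eval_aeval']
  simp
  rfl

lemma sub2_hom (p v : Fin 2 → ℂ) (P) (hP : P.IsHomogeneous 3) : (sub2 p v P).IsHomogeneous 3 := by
  have := hP.aeval (fun i => C (p i) * X 0 + C (v i) * X 1 : Fin 2 → MvPolynomial (Fin 2) ℂ) (n := 1)
    (fun i => ((isHomogeneous_C_mul_X _ _).add (isHomogeneous_C_mul_X _ _)))
  exact this

lemma pullback (A B Cc : MvPolynomial (Fin 2) ℂ) (p v : Fin 2 → ℂ) (u t : ℂ) :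
    pb3 !![p 0, v 0, 0; p 1, v 1, 0; 0, t, u] (OmABC A B Cc) =
     OmABC (C u * (C (p 0) * sub2 p v A + C (p 1) * sub2 p v B))
       (C u * (C (v 0) * sub2 p v A + C (v 1) * sub2 p v B))
       (C (p 0 * v 1 - p 1 * v 0) * sub2 p v Cc
         - C t * (C (p 0) * sub2 p v A + C (p 1) * sub2 p v B)) := by
  funext i
  apply MvPolynomial.funext
  intro x
  have hv : (fun i => p i * x 0 + v i * x 1) = ![p 0 * x 0 + v 0 * x 1, p 1 * x 0 + v 1 * x 1] := by
    ext i; fin_cases i <;> rfl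
  fin_cases i <;>
  · simp [pb3, OmABC, Fin.sum_univ_three, eval_subst3, eval_emb, eval_sub2, dotProduct, hv]
    ring

lemma OmABC_smul (c : ℂ) (A B Cc : MvPolynomial (Fin 2) ℂ) :
    OmABC (C c * A) (C c * B) (C c * Cc) = fun i => C c * OmABC A B Cc i := by
  have : emb (C c) = C c := by simp [emb]
  funext i
  fin_cases i <;>
  · simp [OmABC, this]
    ring

/-- **Degree-3 foliations with a multiplicity-3 singularity, further singular points,
and non-saturated 3-jet.**
Let `F` be a degree-3 foliation of `ℙ²(ℂ)` with a singular point `m = [0:0:1]` of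
algebraic multiplicity 3, given by `ω = A dx + B dy + C(x dy − y dx)` with `A, B, C`
homogeneous of degree 3.  If the singular locus of `F` is not reduced to `m`, and the
3-jet `A dx + B dy` of `ω` at `m` is not saturated (i.e. `A` and `B` have a nonconstant
common factor), then `Ω` is `GL₃(ℂ)`-conjugate, up to a nonzero scalar, to the 1-form
associated to
`y(a₀x² + a₁xy + y²)dx + xy(b₀x + b₁y)dy + x(x² + c₁xy + c₂y²)(x dy − y dx)`
for complex numbers `a₀, a₁, b₀, b₁, c₁, c₂` such that the associated foliation has
degree 3. -/
theorem stmt_7 (A B Cc : MvPolynomial (Fin 2) ℂ)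
    (hA : A.IsHomogeneous 3) (hB : B.IsHomogeneous 3) (hC : Cc.IsHomogeneous 3)
    (hdeg : OmABC A B Cc ≠ 0 ∧
      ∀ h : MvPolynomial (Fin 3) ℂ, (∀ i, h ∣ OmABC A B Cc i) → IsUnit h)
    (hsing : ∃ v : Fin 3 → ℂ, v ≠ 0 ∧ (∀ i, eval v (OmABC A B Cc i) = 0) ∧
      ¬ (v 0 = 0 ∧ v 1 = 0))
    (hjet : ∃ h : MvPolynomial (Fin 2) ℂ, h ≠ 0 ∧ ¬ IsUnit h ∧ h ∣ A ∧ h ∣ B) :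
    ∃ a₀ a₁ b₀ b₁ c₁ c₂ : ℂ,
      (OmABC (X 1 * (C a₀ * X 0 ^ 2 + C a₁ * X 0 * X 1 + X 1 ^ 2))
          (X 0 * X 1 * (C b₀ * X 0 + C b₁ * X 1))
          (X 0 * (X 0 ^ 2 + C c₁ * X 0 * X 1 + C c₂ * X 1 ^ 2)) ≠ 0 ∧
        ∀ h : MvPolynomial (Fin 3) ℂ,
          (∀ i, h ∣ OmABC (X 1 * (C a₀ * X 0 ^ 2 + C a₁ * X 0 * X 1 + X 1 ^ 2))
            (X 0 * X 1 * (C b₀ * X 0 + C b₁ * X 1))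
            (X 0 * (X 0 ^ 2 + C c₁ * X 0 * X 1 + C c₂ * X 1 ^ 2)) i) → IsUnit h) ∧
      LinConj3 (OmABC A B Cc)
        (OmABC (X 1 * (C a₀ * X 0 ^ 2 + C a₁ * X 0 * X 1 + X 1 ^ 2))
          (X 0 * X 1 * (C b₀ * X 0 + C b₁ * X 1))
          (X 0 * (X 0 ^ 2 + C c₁ * X 0 * X 1 + C c₂ * X 1 ^ 2))) := by
  obtain ⟨-, hprim⟩ := hdeg
  obtain ⟨w, hw, hsw, hwn⟩ := hsing
  obtain ⟨h, h0, hu, hhA, hhB⟩ := hjet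
  obtain ⟨p, hp, hph⟩ := exists_zero h hu
  have hAp : eval p A = 0 := by
    obtain ⟨q, rfl⟩ := hhA; simp [hph]
  have hBp : eval p B = 0 := by
    obtain ⟨q, rfl⟩ := hhB; simp [hph]
  -- no common zero of the three forms
  have hno : ∀ q : Fin 2 → ℂ, q ≠ 0 → eval q A = 0 → eval q B = 0 → eval q Cc ≠ 0 := by
    intro q hq h1 h2 h3
    obtain ⟨a, ha⟩ := map_dvd emb (cubic_dvd A hA q hq h1)
    obtain ⟨b, hb⟩ := map_dvd emb (cubic_dvd B hB q hq h2)
    obtain ⟨c, hc⟩ := map_dvd emb (cubic_dvd Cc hC q hq h3)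
    have hunit := hprim (emb (C (q 1) * X 0 - C (q 0) * X 1)) (by
      intro i
      fin_cases i
      · exact ⟨X 2 * a - X 1 * c, by simp only [OmABC]; simp only [ha, hc]; simp; ring⟩
      · exact ⟨X 2 * b + X 0 * c, by simp only [OmABC]; simp only [hb, hc]; simp; ring⟩
      · exact ⟨-(X 0 * a + X 1 * b), by simp only [OmABC]; simp only [ha, hb]; simp; ring⟩)
    have h4 := hunit.map (eval (0 : Fin 3 → ℂ))
    rw [eval_emb] at h4
    simp at h4
  have hCp := hno p hp hAp hBp
  set v : Fin 2 → ℂ := ![w 0, w 1] with hv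
  have hv0 : v ≠ 0 := by
    intro hv'
    exact hwn ⟨by simpa [hv] using congrFun hv' 0, by simpa [hv] using congrFun hv' 1⟩
  have e0 : w 2 * eval v A - v 1 * eval v Cc = 0 := by
    have := hsw 0
    simp [OmABC, eval_emb, ← hv] at this
    exact this
  have e1 : w 2 * eval v B + v 0 * eval v Cc = 0 := by
    have := hsw 1
    simp [OmABC, eval_emb, ← hv] at this
    exact this
  have e2 : v 0 * eval v A + v 1 * eval v B = 0 := by
    have := hsw 2
    simp [OmABC, eval_emb, ← hv] at this
    simp [hv] at this ⊢
    linear_combination -this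
  have hAB : ¬ (eval v A = 0 ∧ eval v B = 0) := by
    rintro ⟨h1, h2⟩
    have h3 := hno v hv0 h1 h2
    rw [h1] at e0
    rw [h2] at e1
    simp [h3] at e0 e1
    exact hv0 (by ext k; fin_cases k <;> assumption)
  have hδ : p 0 * v 1 - p 1 * v 0 ≠ 0 := by
    intro hδ
    have key : ∀ P : MvPolynomial (Fin 2) ℂ, P.IsHomogeneous 3 → eval p P = 0 → eval v P = 0 := by
      intro P hP h1
      obtain ⟨Q, hQ⟩ := cubic_dvd P hP p hp h1
      rw [hQ]
      simp
      left
      linear_combination -hδ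
    exact hAB ⟨key A hA hAp, key B hB hBp⟩
  have he : p 0 * eval v A + p 1 * eval v B ≠ 0 := by
    intro he
    refine hAB ⟨?_, ?_⟩
    · apply (mul_eq_zero.mp (?_ : (p 0 * v 1 - p 1 * v 0) * eval v A = 0)).resolve_left hδ
      linear_combination v 1 * he - p 1 * e2
    · apply (mul_eq_zero.mp (?_ : (p 0 * v 1 - p 1 * v 0) * eval v B = 0)).resolve_left hδ
      linear_combination p 0 * e2 - v 0 * he
  set δ := p 0 * v 1 - p 1 * v 0 with hδd
  set e := p 0 * eval v A + p 1 * eval v B with hed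
  set c := δ * eval p Cc with hcd
  have hc : c ≠ 0 := mul_ne_zero hδ hCp
  set u := c / e with hud
  have hu0 : u ≠ 0 := div_ne_zero hc he
  have hpull := pullback A B Cc p v u (w 2)
  set A' := C u * (C (p 0) * sub2 p v A + C (p 1) * sub2 p v B) with hA'
  set B' := C u * (C (v 0) * sub2 p v A + C (v 1) * sub2 p v B) with hB'
  set C' := C (p 0 * v 1 - p 1 * v 0) * sub2 p v Cc
         - C (w 2) * (C (p 0) * sub2 p v A + C (p 1) * sub2 p v B) with hC'
  have hsA := sub2_hom p v A hA
  have hsB := sub2_hom p v B hB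
  have hsC := sub2_hom p v Cc hC
  have hA'h : A'.IsHomogeneous 3 := ((hsA.C_mul _).add (hsB.C_mul _)).C_mul _
  have hB'h : B'.IsHomogeneous 3 := ((hsA.C_mul _).add (hsB.C_mul _)).C_mul _
  have hC'h : C'.IsHomogeneous 3 := (hsC.C_mul _).sub (((hsA.C_mul _).add (hsB.C_mul _)).C_mul _)
  have ev1 : ∀ P, eval ![1, 0] (sub2 p v P) = eval p P := by
    intro P; rw [eval_sub2]; simp
  have ev2 : ∀ P, eval ![0, 1] (sub2 p v P) = eval v P := by
    intro P; rw [eval_sub2]; simp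
  have vA1 : eval ![1, 0] A' = 0 := by simp [hA', ev1, hAp, hBp]
  have vA2 : eval ![0, 1] A' = c := by
    simp only [hA', map_mul, map_add, ev2, eval_C, ← hed, hud]
    field_simp
  have vB1 : eval ![1, 0] B' = 0 := by simp [hB', ev1, hAp, hBp]
  have vB2 : eval ![0, 1] B' = 0 := by
    simp only [hB', map_mul, map_add, ev2, eval_C, e2, mul_zero]
  have vC1 : eval ![1, 0] C' = c := by
    simp only [hC', map_mul, map_add, map_sub, ev1, eval_C, hAp, hBp, hcd, hδd]
    ring
  have vC2 : eval ![0, 1] C' = 0 := by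
    simp only [hC', map_mul, map_add, map_sub, ev2, eval_C]
    linear_combination -p 0 * e0 - p 1 * e1
  clear_value A' B' C'
  obtain ⟨α0, α1, α2, α3, hα⟩ := cubic_form A' hA'h
  obtain ⟨β0, β1, β2, β3, hβ⟩ := cubic_form B' hB'h
  obtain ⟨γ0, γ1, γ2, γ3, hγ⟩ := cubic_form C' hC'h
  rw [hα] at vA1 vA2
  rw [hβ] at vB1 vB2
  rw [hγ] at vC1 vC2
  simp at vA1 vA2 vB1 vB2 vC1 vC2
  have fA : A' = C c * (X 1 * (C (α1 / c) * X 0 ^ 2 + C (α2 / c) * X 0 * X 1 + X 1 ^ 2)) := by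
    rw [hα, vA1, vA2]
    apply MvPolynomial.funext
    intro x
    simp
    field_simp
  have fB : B' = C c * (X 0 * X 1 * (C (β1 / c) * X 0 + C (β2 / c) * X 1)) := by
    rw [hβ, vB1, vB2]
    apply MvPolynomial.funext
    intro x
    simp
    field_simp
  have fC : C' = C c * (X 0 * (X 0 ^ 2 + C (γ1 / c) * X 0 * X 1 + C (γ2 / c) * X 1 ^ 2)) := by
    rw [hγ, vC1, vC2]
    apply MvPolynomial.funext
    intro x
    simp
    field_simp
  rw [fA, fB, fC, OmABC_smul] at hpull
  have hdet : IsUnit (!![p 0, v 0, 0; p 1, v 1, 0; 0, w 2, u] : Matrix (Fin 3) (Fin 3) ℂ).det := by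
    rw [isUnit_iff_ne_zero]
    have : (!![p 0, v 0, 0; p 1, v 1, 0; 0, w 2, u] : Matrix (Fin 3) (Fin 3) ℂ).det = δ * u := by
      rw [Matrix.det_fin_three]
      simp only [Matrix.of_apply, Matrix.cons_val', Matrix.cons_val, hδd]
      ring
    rw [this]
    exact mul_ne_zero hδ hu0
  have htr := isUnit_transfer _ c hdet _ _ hpull hprim
  refine ⟨α1 / c, α2 / c, β1 / c, β2 / c, γ1 / c, γ2 / c, ⟨?_, htr⟩, _, c, hdet, hc, hpull⟩
  intro hz
  have := htr 0 (by intro i; rw [hz]; simp)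
  simp at this
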